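/- arXiv:2505.01600 — 2 statements merged into one kernel-verified Lean document; each statement's English description precedes it below -/
import Mathlib

section
/- Under the linear panel data model with heterogeneous (random) coefficients, the instrument setup, Assumptions 1, 2 and 3, and the compact support regularity, define L_V = sup over λ < 0 and μ ∈ ℝ^L of E[ min_{b ∈ ℬ} { μ'SY + (λ R'Y − R'S'μ)'b − b'(λ R'R − e₀)b } ]. Then L_V ≤ E(B'e₀B). -/
open MeasureTheory Matrix

noncomputable section

/-- An `m`-measurable factor is orthogonal to a variable with vanishing conditional expectation. -/
theorem integral_mul_eq_zero_of_condExp_eq_zero {Ω : Type*} {m m0 : MeasurableSpace Ω}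
    {μ : Measure Ω} [IsFiniteMeasure μ] (hm : m ≤ m0) {f g : Ω → ℝ}
    (hf : StronglyMeasurable[m] f) (hg : Integrable g μ) (hfg : Integrable (f * g) μ)
    (h : μ[g|m] =ᵐ[μ] 0) : ∫ ω, f ω * g ω ∂μ = 0 := by
  have hpull : μ[f * g|m] =ᵐ[μ] 0 := by
    filter_upwards [condExp_mul_of_stronglyMeasurable_left hf hfg hg, h] with ω h1 h2
    simp [h1, h2]
  calc ∫ ω, f ω * g ω ∂μ = ∫ ω, (μ[f * g|m]) ω ∂μ := (integral_condExp hm).symm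
    _ = 0 := by rw [integral_congr_ae hpull]; simp

/-- The dual objective rewritten in terms of the residual `y - A b`. -/
theorem dual_objective_eq {m n k : Type*} [Fintype m] [Fintype n] [Fintype k]
    (A : Matrix m n ℝ) (C : Matrix k m ℝ) (D : Matrix n n ℝ) (y : m → ℝ) (b : n → ℝ)
    (u : k → ℝ) (l : ℝ) :
    u ⬝ᵥ (C *ᵥ y) + (l • (Aᵀ *ᵥ y) - Aᵀ *ᵥ (Cᵀ *ᵥ u)) ⬝ᵥ b - b ⬝ᵥ ((l • (Aᵀ * A) - D) *ᵥ b)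
      = u ⬝ᵥ (C *ᵥ (y - A *ᵥ b)) + l * ((A *ᵥ b) ⬝ᵥ (y - A *ᵥ b)) + b ⬝ᵥ (D *ᵥ b) := by
  have hC : (Aᵀ *ᵥ (Cᵀ *ᵥ u)) ⬝ᵥ b = u ⬝ᵥ (C *ᵥ (A *ᵥ b)) := by
    rw [mulVec_transpose, mulVec_transpose, ← dotProduct_mulVec, ← dotProduct_mulVec]
  have hy : (Aᵀ *ᵥ y) ⬝ᵥ b = (A *ᵥ b) ⬝ᵥ y := by
    rw [mulVec_transpose, ← dotProduct_mulVec, dotProduct_comm]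
  have hA : b ⬝ᵥ ((Aᵀ * A) *ᵥ b) = (A *ᵥ b) ⬝ᵥ (A *ᵥ b) := by
    rw [← mulVec_mulVec, dotProduct_mulVec, vecMul_transpose]
  simp only [sub_dotProduct, smul_dotProduct, sub_mulVec, smul_mulVec, dotProduct_sub,
    dotProduct_smul, mulVec_sub, smul_eq_mul, hC, hy, hA]
  ring

/-- **Lower bound for the second moment of a random coefficient (Proposition 6).**
Under the dynamic random coefficient model with instruments and compact support,
`L_V = sup_{λ<0, μ'} E[min_{b∈ℬ} {μ''SY + (λR'Y − R'S'μ'')'b − b'(λR'R − e₀)b}]`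
is a lower bound for `E(B'e₀B)`. -/
theorem second_moment_lower_bound
    {T q p : ℕ} (hT : 1 ≤ T) (hqp : 1 ≤ q + p)
    {Ω : Type*} [MeasurableSpace Ω] (μ : Measure Ω) [IsProbabilityMeasure μ]
    (Z : Fin T → Ω → Fin q → ℝ) (X : Fin T → Ω → Fin p → ℝ)
    (Y : Ω → Fin T → ℝ) (B : Ω → Fin (q + p) → ℝ)
    (hZ : ∀ t, Measurable (Z t)) (hX : ∀ t, Measurable (X t))
    (hY : Measurable Y) (hB : Measurable B)
    (R : Ω → Matrix (Fin T) (Fin (q + p)) ℝ)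
    (hR : ∀ ω t, R ω t = Fin.append (Z t ω) (X t ω))
    -- Assumption 1 (sequential exogeneity)
    (hεint : ∀ t : Fin T, Integrable (fun ω => Y ω t - R ω t ⬝ᵥ B ω) μ)
    (hA1 : ∀ t : Fin T,
      μ[(fun ω => Y ω t - R ω t ⬝ᵥ B ω)|
        MeasurableSpace.comap
          (fun ω => (B ω, fun u : Fin T => Z u ω, fun u : {u : Fin T // u ≤ t} => X u.1 ω))
          inferInstance] =ᵐ[μ] 0)
    -- Assumption 2 (no multicollinearity)
    (hA2 : ∀ᵐ ω ∂μ, ((R ω)ᵀ * R ω).PosDef)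
    -- instrument setup
    (L : Fin T → ℕ) (St : (t : Fin T) → Ω → Fin (L t) → ℝ)
    (hSt : ∀ t, Measurable (St t))
    (S : Ω → Matrix ((t : Fin T) × Fin (L t)) (Fin T) ℝ)
    (hSdef : ∀ ω (pr : (t : Fin T) × Fin (L t)) (u : Fin T),
      S ω pr u = if u = pr.1 then St pr.1 ω pr.2 else 0)
    (hSεint : ∀ (t : Fin T) (i : Fin (L t)),
      Integrable (fun ω => St t ω i * (Y ω t - R ω t ⬝ᵥ B ω)) μ)
    (hSε : ∀ (t : Fin T) (i : Fin (L t)),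
      ∫ ω, St t ω i * (Y ω t - R ω t ⬝ᵥ B ω) ∂μ = 0)
    -- Assumption 3
    (hA3 : ∀ a : (t : Fin T) → Fin (L t) → ℝ, a ≠ 0 →
      0 < μ {ω | ∑ t, (St t ω ⬝ᵥ a t) • R ω t ≠ 0})
    -- compact support regularity
    (Bset : Set (Fin (q + p) → ℝ)) (hBcomp : IsCompact Bset)
    (hBsupp : ∀ᵐ ω ∂μ, B ω ∈ Bset)
    (c : ℝ)
    (hbd : ∀ᵐ ω ∂μ, (∀ t, |Y ω t| ≤ c) ∧ (∀ t j, |R ω t j| ≤ c) ∧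
      (∀ (pr : (t : Fin T) × Fin (L t)) (u : Fin T), |S ω pr u| ≤ c))
    -- e₀ : diagonal matrix with a single unit diagonal entry
    (j0 : Fin (q + p)) :
    (⨆ lam : {x : ℝ // x < 0}, ⨆ mu : ((t : Fin T) × Fin (L t)) → ℝ,
      ∫ ω, (⨅ b : Bset,
        (mu ⬝ᵥ (S ω *ᵥ Y ω)
          + ((lam.1 • ((R ω)ᵀ *ᵥ Y ω)) - (R ω)ᵀ *ᵥ ((S ω)ᵀ *ᵥ mu)) ⬝ᵥ b.1
          - b.1 ⬝ᵥ ((lam.1 • ((R ω)ᵀ * R ω) -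
              Matrix.diagonal (Pi.single j0 (1 : ℝ))) *ᵥ b.1))) ∂μ)
      ≤ ∫ ω, B ω ⬝ᵥ (Matrix.diagonal (Pi.single j0 (1 : ℝ)) *ᵥ B ω) ∂μ := by
  have hRcoord : ∀ t j, Measurable fun ω => R ω t j := by
    intro t j
    simp only [hR]
    refine Fin.addCases (fun i => ?_) (fun i => ?_) j
    · simpa using measurable_pi_iff.1 (hZ t) i
    · simpa using measurable_pi_iff.1 (hX t) i
  have hBcoord : ∀ j, Measurable fun ω => B ω j := measurable_pi_iff.1 hB
  obtain ⟨K, hK⟩ := hBcomp.isBounded.exists_norm_le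
  have hBbd : ∀ᵐ ω ∂μ, ∀ j, ‖B ω j‖ ≤ K := by
    filter_upwards [hBsupp] with ω hω j
    exact (norm_le_pi_norm (B ω) j).trans (hK _ hω)
  have hfit : ∀ t, Integrable (fun ω => (R ω t ⬝ᵥ B ω) * (Y ω t - R ω t ⬝ᵥ B ω)) μ := by
    intro t
    refine (hεint t).bdd_mul (c := ∑ _j : Fin (q + p), c * K) ?_ ?_
    · exact (Finset.measurable_sum _ fun j _ =>
        (hRcoord t j).mul (hBcoord j)).aestronglyMeasurable
    · filter_upwards [hbd, hBbd] with ω h1 h2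
      refine (norm_sum_le _ _).trans (Finset.sum_le_sum fun j _ => ?_)
      rw [norm_mul]
      exact mul_le_mul (h1.2.1 t j) (h2 j) (norm_nonneg _) ((abs_nonneg _).trans (h1.2.1 t j))
  have hfit_zero : ∀ t, ∫ ω, (R ω t ⬝ᵥ B ω) * (Y ω t - R ω t ⬝ᵥ B ω) ∂μ = 0 := by
    intro t
    refine integral_mul_eq_zero_of_condExp_eq_zero ?_ ?_ (hεint t) (hfit t) (hA1 t)
    · refine Measurable.comap_le ?_
      fun_prop
    · have hinfo := comap_measurable (m := inferInstance)
        (fun ω => (B ω, fun u : Fin T => Z u ω, fun u : {u : Fin T // u ≤ t} => X u.1 ω))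
      have hval : Measurable fun v : (Fin (q + p) → ℝ) × (Fin T → Fin q → ℝ) ×
          ({u : Fin T // u ≤ t} → Fin p → ℝ) =>
          Fin.append (v.2.1 t) (v.2.2 ⟨t, le_rfl⟩) ⬝ᵥ v.1 := by
        refine Finset.measurable_sum _ fun j _ => ?_
        refine Measurable.mul ?_ (by fun_prop)
        refine Fin.addCases (fun i => ?_) (fun i => ?_) j
        · simp only [Fin.append_left]; fun_prop
        · simp only [Fin.append_right]; fun_prop
      have := hval.comp hinfo
      simp only [hR]
      exact this.stronglyMeasurable
  have hquad : ∀ b : Fin (q + p) → ℝ,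
      b ⬝ᵥ (Matrix.diagonal (Pi.single j0 (1 : ℝ)) *ᵥ b) = b j0 * b j0 := by
    intro b
    simp [dotProduct, mulVec_diagonal, Pi.single_apply]
  have hquad_int : Integrable (fun ω => B ω j0 * B ω j0) μ := by
    have hbdd : ∀ᵐ ω ∂μ, ‖B ω j0‖ ≤ K := hBbd.mono fun ω h => h j0
    exact (Integrable.of_bound (hBcoord j0).aestronglyMeasurable K hbdd).bdd_mul
      (hBcoord j0).aestronglyMeasurable hbdd
  simp only [hquad]
  have hnonneg : 0 ≤ ∫ ω, B ω j0 * B ω j0 ∂μ := integral_nonneg fun ω => mul_self_nonneg _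
  refine Real.iSup_le (fun lam => Real.iSup_le (fun mu => ?_) hnonneg) hnonneg
  have hinstr : ∀ ω, mu ⬝ᵥ (S ω *ᵥ (Y ω - R ω *ᵥ B ω))
      = ∑ pr, mu pr * (St pr.1 ω pr.2 * (Y ω pr.1 - R ω pr.1 ⬝ᵥ B ω)) := by
    intro ω
    refine Finset.sum_congr rfl fun pr _ => ?_
    simp [mulVec, dotProduct, hSdef]
  have hres_int : Integrable (fun ω =>
      ∑ pr : (t : Fin T) × Fin (L t),
        mu pr * (St pr.1 ω pr.2 * (Y ω pr.1 - R ω pr.1 ⬝ᵥ B ω))) μ :=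
    integrable_finsetSum _ fun pr _ => (hSεint pr.1 pr.2).const_mul _
  have hfit_int : Integrable (fun ω =>
      lam.1 * ∑ t, (R ω t ⬝ᵥ B ω) * (Y ω t - R ω t ⬝ᵥ B ω)) μ :=
    (integrable_finsetSum _ fun t _ => hfit t).const_mul _
  have hsum_int : Integrable (fun ω => (∑ pr : (t : Fin T) × Fin (L t),
        mu pr * (St pr.1 ω pr.2 * (Y ω pr.1 - R ω pr.1 ⬝ᵥ B ω)))
      + lam.1 * ∑ t, (R ω t ⬝ᵥ B ω) * (Y ω t - R ω t ⬝ᵥ B ω)) μ := hres_int.add hfit_int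
  by_cases hmin : Integrable (fun ω => ⨅ b : Bset,
      (mu ⬝ᵥ (S ω *ᵥ Y ω)
        + ((lam.1 • ((R ω)ᵀ *ᵥ Y ω)) - (R ω)ᵀ *ᵥ ((S ω)ᵀ *ᵥ mu)) ⬝ᵥ b.1
        - b.1 ⬝ᵥ ((lam.1 • ((R ω)ᵀ * R ω) -
            Matrix.diagonal (Pi.single j0 (1 : ℝ))) *ᵥ b.1))) μ
  swap
  · rwa [integral_undef hmin]
  calc _ ≤ ∫ ω, ((∑ pr : (t : Fin T) × Fin (L t),
            mu pr * (St pr.1 ω pr.2 * (Y ω pr.1 - R ω pr.1 ⬝ᵥ B ω)))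
          + lam.1 * ∑ t, (R ω t ⬝ᵥ B ω) * (Y ω t - R ω t ⬝ᵥ B ω)) + B ω j0 * B ω j0 ∂μ := by
        refine integral_mono_ae hmin (hsum_int.add hquad_int) ?_
        filter_upwards [hBsupp] with ω hω
        have hcont : Continuous fun b : Fin (q + p) → ℝ => mu ⬝ᵥ (S ω *ᵥ Y ω)
            + ((lam.1 • ((R ω)ᵀ *ᵥ Y ω)) - (R ω)ᵀ *ᵥ ((S ω)ᵀ *ᵥ mu)) ⬝ᵥ b
            - b ⬝ᵥ ((lam.1 • ((R ω)ᵀ * R ω) -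
                Matrix.diagonal (Pi.single j0 (1 : ℝ))) *ᵥ b) := by
          fun_prop
        have hbelow := hBcomp.bddBelow_image hcont.continuousOn
        rw [Set.image_eq_range] at hbelow
        refine (ciInf_le hbelow ⟨B ω, hω⟩).trans_eq ?_
        rw [dual_objective_eq, hinstr, hquad]
        rfl
    _ = ∫ ω, B ω j0 * B ω j0 ∂μ := by
        rw [integral_add hsum_int hquad_int, integral_add hres_int hfit_int,
          integral_const_mul, integral_finsetSum _ fun t _ => hfit t,
          integral_finsetSum _ fun pr _ => (hSεint pr.1 pr.2).const_mul _]
        simp only [integral_const_mul, hSε, hfit_zero]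
        simp
end
end

section
/- Under the linear panel data model with heterogeneous (random) coefficients, the instrument setup, Assumptions 1, 2 and 3, and the compact support regularity, fix e ∈ ℝ^r and c ∈ ℝ and suppose both {b ∈ ℬ : e'b ≤ c} and {b ∈ ℬ : e'b > c} are nonempty. For λ ∈ ℝ and μ ∈ ℝ^L define the random variables G_{L,F}(λ, μ) = min{ inf over b ∈ ℬ with e'b ≤ c of [1 + λ b'R'(Y − Rb) + μ'S(Y − Rb)], inf over b ∈ ℬ with e'b > c of [λ b'R'(Y − Rb) + μ'S(Y − Rb)] } and G_{U,F}(λ, μ) = max{ sup over b ∈ ℬ with e'b ≤ c of [1 + λ b'R'(Y − Rb) + μ'S(Y − Rb)], sup over b ∈ ℬ with e'b > c of [λ b'R'(Y − Rb) + μ'S(Y − Rb)] }. Then sup_{λ < 0, μ ∈ ℝ^L} E[G_{L,F}(λ, μ)] ≤ P(e'B ≤ c) ≤ inf_{λ > 0, μ ∈ ℝ^L} E[G_{U,F}(λ, μ)]. -/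
open MeasureTheory Matrix

noncomputable section

section SupremumOfContinuousFamily

variable {Ω ι : Type*} [MeasurableSpace Ω] {μ : Measure Ω} [TopologicalSpace ι]
  [TopologicalSpace.SeparableSpace ι] [Nonempty ι]

/-- The supremum of a continuous real function is its supremum along a dense sequence. -/
theorem Continuous.iSup_denseSeq {g : ι → ℝ} (hg : Continuous g) :
    ⨆ n, g (TopologicalSpace.denseSeq ι n) = ⨆ i, g i := by
  have hsub : Set.range g ⊆ closure (Set.range fun n => g (TopologicalSpace.denseSeq ι n)) := by
    have h := hg.range_subset_closure_image_dense (TopologicalSpace.denseRange_denseSeq ι)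
    rwa [← Set.range_comp] at h
  have hub : upperBounds (Set.range fun n => g (TopologicalSpace.denseSeq ι n))
      = upperBounds (Set.range g) := by
    refine Set.Subset.antisymm ?_ (upperBounds_mono_set ?_)
    · rw [← upperBounds_closure]
      exact upperBounds_mono_set hsub
    · rintro _ ⟨n, rfl⟩
      exact ⟨_, rfl⟩
  by_cases hb : BddAbove (Set.range g)
  · refine (IsLUB.csSup_eq ?_ (Set.range_nonempty _))
    unfold IsLUB
    rw [hub]
    exact isLUB_csSup (Set.range_nonempty g) hb
  · rw [Real.iSup_of_not_bddAbove hb, Real.iSup_of_not_bddAbove]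
    unfold BddAbove
    rwa [hub]

theorem integrable_iSup_of_continuous [IsFiniteMeasure μ] {g : Ω → ι → ℝ}
    (hmeas : ∀ i, Measurable fun ω => g ω i) (hcont : ∀ ω, Continuous (g ω))
    {C : ℝ} (hC : ∀ᵐ ω ∂μ, ∀ i, |g ω i| ≤ C) :
    Integrable (fun ω => ⨆ i, g ω i) μ := by
  refine Integrable.of_bound (Measurable.aestronglyMeasurable ?_) C ?_
  · simp_rw [← fun ω => (hcont ω).iSup_denseSeq]
    exact Measurable.iSup fun n => hmeas _
  · filter_upwards [hC] with ω hω
    obtain ⟨i⟩ := ‹Nonempty ι›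
    rw [Real.norm_eq_abs, abs_le]
    refine ⟨(abs_le.1 (hω i)).1.trans (le_ciSup ⟨C, ?_⟩ i), ciSup_le fun j => (abs_le.1 (hω j)).2⟩
    rintro _ ⟨j, rfl⟩
    exact (abs_le.1 (hω j)).2

theorem integrable_iInf_of_continuous [IsFiniteMeasure μ] {g : Ω → ι → ℝ}
    (hmeas : ∀ i, Measurable fun ω => g ω i) (hcont : ∀ ω, Continuous (g ω))
    {C : ℝ} (hC : ∀ᵐ ω ∂μ, ∀ i, |g ω i| ≤ C) :
    Integrable (fun ω => ⨅ i, g ω i) μ := by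
  have h := (integrable_iSup_of_continuous (μ := μ) (g := fun ω i => -g ω i)
    (fun i => (hmeas i).neg) (fun ω => (hcont ω).neg) (C := C) (by simpa using hC)).neg
  refine h.congr (ae_of_all _ fun ω => ?_)
  change -(⨆ i, -g ω i) = ⨅ i, g ω i
  rw [← sInf_range, Real.sInf_def, ← sSup_range]
  congr 2
  ext x
  simp [neg_eq_iff_eq_neg]

end SupremumOfContinuousFamily

theorem integral_indicator_add_eq {Ω E : Type*} [MeasurableSpace Ω] {μ : Measure Ω}
    [IsProbabilityMeasure μ] {φ : E → ℝ} {cc : ℝ} {B : Ω → E} {g : Ω → E → ℝ}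
    (hs : MeasurableSet {ω | φ (B ω) ≤ cc})
    (hint : Integrable (fun ω => g ω (B ω)) μ) (hzero : ∫ ω, g ω (B ω) ∂μ = 0) :
    ∫ ω, ({ω | φ (B ω) ≤ cc}.indicator (fun _ => (1 : ℝ)) ω + g ω (B ω)) ∂μ
      = (μ {ω | φ (B ω) ≤ cc}).toReal := by
  rw [integral_add ((integrable_const _).indicator hs) hint, hzero, add_zero,
    integral_indicator hs]
  simp [Measure.real]

section SplitSupport

variable {Ω E : Type*} [MeasurableSpace Ω] {μ : Measure Ω} [IsProbabilityMeasure μ]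
  [TopologicalSpace E] [SecondCountableTopology E]
  {K : Set E} {φ : E → ℝ} {cc C : ℝ} {B : Ω → E} {g : Ω → E → ℝ}

theorem measure_le_integral_max_iSup (hs : MeasurableSet {ω | φ (B ω) ≤ cc})
    (hint : Integrable (fun ω => g ω (B ω)) μ) (hzero : ∫ ω, g ω (B ω) ∂μ = 0)
    (hBK : ∀ᵐ ω ∂μ, B ω ∈ K) (hmeas : ∀ b, Measurable fun ω => g ω b)
    (hcont : ∀ ω, Continuous (g ω)) (hC : ∀ᵐ ω ∂μ, ∀ b ∈ K, |g ω b| ≤ C)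
    (hne1 : {b | b ∈ K ∧ φ b ≤ cc}.Nonempty) (hne2 : {b | b ∈ K ∧ cc < φ b}.Nonempty) :
    (μ {ω | φ (B ω) ≤ cc}).toReal ≤
      ∫ ω, max (⨆ b : {b // b ∈ K ∧ φ b ≤ cc}, (1 + g ω b.1))
        (⨆ b : {b // b ∈ K ∧ cc < φ b}, g ω b.1) ∂μ := by
  have : Nonempty {b // b ∈ K ∧ φ b ≤ cc} := hne1.to_subtype
  have : Nonempty {b // b ∈ K ∧ cc < φ b} := hne2.to_subtype
  have : SecondCountableTopology {b // b ∈ K ∧ φ b ≤ cc} :=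
    TopologicalSpace.Subtype.secondCountableTopology {b | b ∈ K ∧ φ b ≤ cc}
  have : SecondCountableTopology {b // b ∈ K ∧ cc < φ b} :=
    TopologicalSpace.Subtype.secondCountableTopology {b | b ∈ K ∧ cc < φ b}
  have hC1 : ∀ᵐ ω ∂μ, ∀ b : {b // b ∈ K ∧ φ b ≤ cc}, |1 + g ω b.1| ≤ 1 + C := by
    filter_upwards [hC] with ω hω b
    exact (abs_add_le _ _).trans (by simpa using hω b.1 b.2.1)
  have hC2 : ∀ᵐ ω ∂μ, ∀ b : {b // b ∈ K ∧ cc < φ b}, |g ω b.1| ≤ C := by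
    filter_upwards [hC] with ω hω b using hω b.1 b.2.1
  rw [← integral_indicator_add_eq hs hint hzero]
  refine integral_mono_ae (((integrable_const _).indicator hs).add hint)
    (Integrable.sup
      (integrable_iSup_of_continuous (fun b => (hmeas b.1).const_add 1)
        (fun ω => continuous_const.add ((hcont ω).comp continuous_subtype_val)) hC1)
      (integrable_iSup_of_continuous (fun b => hmeas b.1)
        (fun ω => (hcont ω).comp continuous_subtype_val) hC2)) ?_
  filter_upwards [hBK, hC1, hC2] with ω hω h1 h2
  by_cases h : φ (B ω) ≤ cc
  · rw [Set.indicator_of_mem (by exact h)]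
    refine le_max_of_le_left (le_ciSup (f := fun b : {b // b ∈ K ∧ φ b ≤ cc} => 1 + g ω b.1)
      ⟨1 + C, ?_⟩ ⟨B ω, hω, h⟩)
    rintro _ ⟨b, rfl⟩
    exact (abs_le.1 (h1 b)).2
  · rw [Set.indicator_of_notMem (by exact h), zero_add]
    refine le_max_of_le_right (le_ciSup (f := fun b : {b // b ∈ K ∧ cc < φ b} => g ω b.1)
      ⟨C, ?_⟩ ⟨B ω, hω, not_le.1 h⟩)
    rintro _ ⟨b, rfl⟩
    exact (abs_le.1 (h2 b)).2

theorem integral_min_iInf_le_measure (hs : MeasurableSet {ω | φ (B ω) ≤ cc})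
    (hint : Integrable (fun ω => g ω (B ω)) μ) (hzero : ∫ ω, g ω (B ω) ∂μ = 0)
    (hBK : ∀ᵐ ω ∂μ, B ω ∈ K) (hmeas : ∀ b, Measurable fun ω => g ω b)
    (hcont : ∀ ω, Continuous (g ω)) (hC : ∀ᵐ ω ∂μ, ∀ b ∈ K, |g ω b| ≤ C)
    (hne1 : {b | b ∈ K ∧ φ b ≤ cc}.Nonempty) (hne2 : {b | b ∈ K ∧ cc < φ b}.Nonempty) :
    ∫ ω, min (⨅ b : {b // b ∈ K ∧ φ b ≤ cc}, (1 + g ω b.1))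
        (⨅ b : {b // b ∈ K ∧ cc < φ b}, g ω b.1) ∂μ ≤ (μ {ω | φ (B ω) ≤ cc}).toReal := by
  have : Nonempty {b // b ∈ K ∧ φ b ≤ cc} := hne1.to_subtype
  have : Nonempty {b // b ∈ K ∧ cc < φ b} := hne2.to_subtype
  have : SecondCountableTopology {b // b ∈ K ∧ φ b ≤ cc} :=
    TopologicalSpace.Subtype.secondCountableTopology {b | b ∈ K ∧ φ b ≤ cc}
  have : SecondCountableTopology {b // b ∈ K ∧ cc < φ b} :=
    TopologicalSpace.Subtype.secondCountableTopology {b | b ∈ K ∧ cc < φ b}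
  have hC1 : ∀ᵐ ω ∂μ, ∀ b : {b // b ∈ K ∧ φ b ≤ cc}, |1 + g ω b.1| ≤ 1 + C := by
    filter_upwards [hC] with ω hω b
    exact (abs_add_le _ _).trans (by simpa using hω b.1 b.2.1)
  have hC2 : ∀ᵐ ω ∂μ, ∀ b : {b // b ∈ K ∧ cc < φ b}, |g ω b.1| ≤ C := by
    filter_upwards [hC] with ω hω b using hω b.1 b.2.1
  rw [← integral_indicator_add_eq hs hint hzero]
  refine integral_mono_ae
    (Integrable.inf
      (integrable_iInf_of_continuous (fun b => (hmeas b.1).const_add 1)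
        (fun ω => continuous_const.add ((hcont ω).comp continuous_subtype_val)) hC1)
      (integrable_iInf_of_continuous (fun b => hmeas b.1)
        (fun ω => (hcont ω).comp continuous_subtype_val) hC2))
    (((integrable_const _).indicator hs).add hint) ?_
  filter_upwards [hBK, hC1, hC2] with ω hω h1 h2
  by_cases h : φ (B ω) ≤ cc
  · rw [Set.indicator_of_mem (by exact h)]
    refine min_le_of_left_le (ciInf_le (f := fun b : {b // b ∈ K ∧ φ b ≤ cc} => 1 + g ω b.1)
      ⟨-(1 + C), ?_⟩ ⟨B ω, hω, h⟩)
    rintro _ ⟨b, rfl⟩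
    exact (abs_le.1 (h1 b)).1
  · rw [Set.indicator_of_notMem (by exact h), zero_add]
    refine min_le_of_right_le (ciInf_le (f := fun b : {b // b ∈ K ∧ cc < φ b} => g ω b.1)
      ⟨-C, ?_⟩ ⟨B ω, hω, not_le.1 h⟩)
    rintro _ ⟨b, rfl⟩
    exact (abs_le.1 (h2 b)).1

end SplitSupport

/-- A bounded `m`-measurable multiple of a function with vanishing conditional expectation given
`m` is integrable with zero integral. -/
theorem integral_mul_eq_zero_of_condExp_eq_zero_s13 {Ω : Type*} {m m₀ : MeasurableSpace Ω}
    {μ : Measure Ω} [IsFiniteMeasure μ] (hm : m ≤ m₀) {f ε : Ω → ℝ} (hf : Measurable[m] f)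
    {C : ℝ} (hC : ∀ᵐ ω ∂μ, |f ω| ≤ C) (hε : Integrable ε μ) (h0 : μ[ε|m] =ᵐ[μ] 0) :
    Integrable (fun ω => f ω * ε ω) μ ∧ ∫ ω, f ω * ε ω ∂μ = 0 := by
  have hi : Integrable (f * ε) μ :=
    hε.bdd_mul (hf.mono hm le_rfl).aestronglyMeasurable hC
  refine ⟨hi, ?_⟩
  have h1 : μ[f * ε|m] =ᵐ[μ] 0 := by
    filter_upwards [condExp_mul_of_stronglyMeasurable_left hf.stronglyMeasurable hi hε, h0]
      with ω h1 h2
    simp [h1, h2]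
  calc ∫ ω, f ω * ε ω ∂μ = ∫ ω, (μ[f * ε|m]) ω ∂μ := (integral_condExp hm).symm
    _ = 0 := by rw [integral_congr_ae h1]; simp

theorem isCompact_matrix_abs_le {m n : Type*} (c : ℝ) :
    IsCompact {M : Matrix m n ℝ | ∀ i j, |M i j| ≤ c} := by
  have h : IsCompact (Set.univ.pi fun _ : m => Set.univ.pi fun _ : n => Set.Icc (-c) c) :=
    isCompact_univ_pi fun _ => isCompact_univ_pi fun _ => isCompact_Icc
  change IsCompact {M : m → n → ℝ | ∀ i j, |M i j| ≤ c}
  convert h using 1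
  ext M
  simp only [Set.mem_ofPred_eq, Set.mem_pi, Set.mem_univ, true_imp_iff, Set.mem_Icc, abs_le]

section MomentFunction

variable {m n k : Type*} [Fintype m] [Fintype n] [Fintype k]

/-- The moment function `lam * ⟨R b, y - R b⟩ + ⟨ν, S (y - R b)⟩`. -/
def momentFunction (lam : ℝ) (ν : k → ℝ) (y : m → ℝ) (R : Matrix m n ℝ) (S : Matrix k m ℝ)
    (b : n → ℝ) : ℝ :=
  lam * (b ⬝ᵥ (Rᵀ *ᵥ (y - R *ᵥ b))) + ν ⬝ᵥ (S *ᵥ (y - R *ᵥ b))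

theorem continuous_momentFunction (lam : ℝ) (ν : k → ℝ) :
    Continuous fun x : (m → ℝ) × Matrix m n ℝ × Matrix k m ℝ × (n → ℝ) =>
      momentFunction lam ν x.1 x.2.1 x.2.2.1 x.2.2.2 := by
  unfold momentFunction
  fun_prop

theorem exists_abs_momentFunction_le (lam : ℝ) (ν : k → ℝ) (c : ℝ) {K : Set (n → ℝ)}
    (hK : IsCompact K) :
    ∃ C, ∀ (y : m → ℝ) (R : Matrix m n ℝ) (S : Matrix k m ℝ), (∀ t, |y t| ≤ c) →
      (∀ t j, |R t j| ≤ c) → (∀ i t, |S i t| ≤ c) →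
      ∀ b ∈ K, |momentFunction lam ν y R S b| ≤ C := by
  have hy : IsCompact {y : m → ℝ | ∀ t, |y t| ≤ c} := by
    have h : IsCompact (Set.univ.pi fun _ : m => Set.Icc (-c) c) :=
      isCompact_univ_pi fun _ => isCompact_Icc
    convert h using 1
    ext y
    simp only [Set.mem_ofPred_eq, Set.mem_pi, Set.mem_univ, true_imp_iff, Set.mem_Icc, abs_le]
  obtain ⟨C, hC⟩ := (hy.prod ((isCompact_matrix_abs_le (m := m) (n := n) c).prod
    ((isCompact_matrix_abs_le (m := k) (n := m) c).prod hK))).exists_bound_of_continuousOn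
      (continuous_momentFunction lam ν).continuousOn
  exact ⟨C, fun y R S h1 h2 h3 b hb => hC (y, R, S, b) ⟨h1, h2, h3, hb⟩⟩

theorem measurable_momentFunction {Ω : Type*} [MeasurableSpace Ω] (lam : ℝ) (ν : k → ℝ)
    {y : Ω → m → ℝ} {R : Ω → Matrix m n ℝ} {S : Ω → Matrix k m ℝ}
    (hy : ∀ t, Measurable fun ω => y ω t) (hR : ∀ t j, Measurable fun ω => R ω t j)
    (hS : ∀ i t, Measurable fun ω => S ω i t) (b : n → ℝ) :
    Measurable fun ω => momentFunction lam ν (y ω) (R ω) (S ω) b := by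
  simp only [momentFunction, dotProduct, mulVec, Matrix.transpose_apply, Pi.sub_apply]
  fun_prop

end MomentFunction

/-- **Bounds on the CDF of a linear combination of random coefficients (Proposition 8).**
Under the dynamic random coefficient model with instruments and compact support, with both
`{b ∈ ℬ : e'b ≤ c}` and `{b ∈ ℬ : e'b > c}` nonempty,
`sup_{λ<0,μ'} E[G_{L,F}] ≤ P(e'B ≤ c) ≤ inf_{λ>0,μ'} E[G_{U,F}]`. -/
theorem cdf_bounds
    {T q p : ℕ} (hT : 1 ≤ T) (hqp : 1 ≤ q + p)
    {Ω : Type*} [MeasurableSpace Ω] (μ : Measure Ω) [IsProbabilityMeasure μ]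
    (Z : Fin T → Ω → Fin q → ℝ) (X : Fin T → Ω → Fin p → ℝ)
    (Y : Ω → Fin T → ℝ) (B : Ω → Fin (q + p) → ℝ)
    (hZ : ∀ t, Measurable (Z t)) (hX : ∀ t, Measurable (X t))
    (hY : Measurable Y) (hB : Measurable B)
    (R : Ω → Matrix (Fin T) (Fin (q + p)) ℝ)
    (hR : ∀ ω t, R ω t = Fin.append (Z t ω) (X t ω))
    -- Assumption 1 (sequential exogeneity)
    (hεint : ∀ t : Fin T, Integrable (fun ω => Y ω t - R ω t ⬝ᵥ B ω) μ)
    (hA1 : ∀ t : Fin T,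
      μ[(fun ω => Y ω t - R ω t ⬝ᵥ B ω)|
        MeasurableSpace.comap
          (fun ω => (B ω, fun u : Fin T => Z u ω, fun u : {u : Fin T // u ≤ t} => X u.1 ω))
          inferInstance] =ᵐ[μ] 0)
    -- Assumption 2 (no multicollinearity)
    (hA2 : ∀ᵐ ω ∂μ, ((R ω)ᵀ * R ω).PosDef)
    -- instrument setup
    (L : Fin T → ℕ) (St : (t : Fin T) → Ω → Fin (L t) → ℝ)
    (hSt : ∀ t, Measurable (St t))
    (S : Ω → Matrix ((t : Fin T) × Fin (L t)) (Fin T) ℝ)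
    (hSdef : ∀ ω (pr : (t : Fin T) × Fin (L t)) (u : Fin T),
      S ω pr u = if u = pr.1 then St pr.1 ω pr.2 else 0)
    (hSεint : ∀ (t : Fin T) (i : Fin (L t)),
      Integrable (fun ω => St t ω i * (Y ω t - R ω t ⬝ᵥ B ω)) μ)
    (hSε : ∀ (t : Fin T) (i : Fin (L t)),
      ∫ ω, St t ω i * (Y ω t - R ω t ⬝ᵥ B ω) ∂μ = 0)
    -- Assumption 3
    (hA3 : ∀ a : (t : Fin T) → Fin (L t) → ℝ, a ≠ 0 →
      0 < μ {ω | ∑ t, (St t ω ⬝ᵥ a t) • R ω t ≠ 0})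
    -- compact support regularity
    (Bset : Set (Fin (q + p) → ℝ)) (hBcomp : IsCompact Bset)
    (hBsupp : ∀ᵐ ω ∂μ, B ω ∈ Bset)
    (c : ℝ)
    (hbd : ∀ᵐ ω ∂μ, (∀ t, |Y ω t| ≤ c) ∧ (∀ t j, |R ω t j| ≤ c) ∧
      (∀ (pr : (t : Fin T) × Fin (L t)) (u : Fin T), |S ω pr u| ≤ c))
    -- the two half-spaces intersect the support
    (e : Fin (q + p) → ℝ) (cc : ℝ)
    (hne1 : {b : Fin (q + p) → ℝ | b ∈ Bset ∧ e ⬝ᵥ b ≤ cc}.Nonempty)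
    (hne2 : {b : Fin (q + p) → ℝ | b ∈ Bset ∧ cc < e ⬝ᵥ b}.Nonempty) :
    (⨆ lam : {x : ℝ // x < 0}, ⨆ mu : ((t : Fin T) × Fin (L t)) → ℝ,
      ∫ ω, min
        (⨅ b : {b : Fin (q + p) → ℝ // b ∈ Bset ∧ e ⬝ᵥ b ≤ cc},
          (1 + lam.1 * (b.1 ⬝ᵥ ((R ω)ᵀ *ᵥ (Y ω - R ω *ᵥ b.1)))
            + mu ⬝ᵥ (S ω *ᵥ (Y ω - R ω *ᵥ b.1))))
        (⨅ b : {b : Fin (q + p) → ℝ // b ∈ Bset ∧ cc < e ⬝ᵥ b},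
          (lam.1 * (b.1 ⬝ᵥ ((R ω)ᵀ *ᵥ (Y ω - R ω *ᵥ b.1)))
            + mu ⬝ᵥ (S ω *ᵥ (Y ω - R ω *ᵥ b.1)))) ∂μ)
      ≤ (μ {ω | e ⬝ᵥ B ω ≤ cc}).toReal ∧
    (μ {ω | e ⬝ᵥ B ω ≤ cc}).toReal ≤
      ⨅ lam : {x : ℝ // 0 < x}, ⨅ mu : ((t : Fin T) × Fin (L t)) → ℝ,
        ∫ ω, max
          (⨆ b : {b : Fin (q + p) → ℝ // b ∈ Bset ∧ e ⬝ᵥ b ≤ cc},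
            (1 + lam.1 * (b.1 ⬝ᵥ ((R ω)ᵀ *ᵥ (Y ω - R ω *ᵥ b.1)))
              + mu ⬝ᵥ (S ω *ᵥ (Y ω - R ω *ᵥ b.1))))
          (⨆ b : {b : Fin (q + p) → ℝ // b ∈ Bset ∧ cc < e ⬝ᵥ b},
            (lam.1 * (b.1 ⬝ᵥ ((R ω)ᵀ *ᵥ (Y ω - R ω *ᵥ b.1)))
              + mu ⬝ᵥ (S ω *ᵥ (Y ω - R ω *ᵥ b.1)))) ∂μ := by
  have hRm : ∀ t j, Measurable fun ω => R ω t j := by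
    intro t j
    simp only [hR]
    refine Fin.addCases (fun i => ?_) (fun i => ?_) j
    · simp only [Fin.append_left]
      exact (measurable_pi_apply i).comp (hZ t)
    · simp only [Fin.append_right]
      exact (measurable_pi_apply i).comp (hX t)
  have hSm : ∀ pr u, Measurable fun ω => S ω pr u := by
    intro pr u
    simp only [hSdef]
    split_ifs
    · exact (measurable_pi_apply _).comp (hSt _)
    · exact measurable_const
  have hfit : ∀ t, Integrable (fun ω => (R ω *ᵥ B ω) t * (Y ω t - R ω t ⬝ᵥ B ω)) μ ∧
      ∫ ω, (R ω *ᵥ B ω) t * (Y ω t - R ω t ⬝ᵥ B ω) ∂μ = 0 := by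
    intro t
    obtain ⟨C, hC⟩ := ((isCompact_matrix_abs_le (m := Fin T) (n := Fin (q + p)) c).prod
      hBcomp).exists_bound_of_continuousOn
        (f := fun x : Matrix (Fin T) (Fin (q + p)) ℝ × (Fin (q + p) → ℝ) => (x.1 *ᵥ x.2) t)
        (by fun_prop)
    refine integral_mul_eq_zero_of_condExp_eq_zero_s13 (Measurable.comap_le ?_) ?_
      (C := C) ?_ (hεint t) (hA1 t)
    · fun_prop
    · let F : (Fin (q + p) → ℝ) × (Fin T → Fin q → ℝ) × ({u : Fin T // u ≤ t} → Fin p → ℝ) → ℝ :=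
        fun x => ∑ j, Fin.append (x.2.1 t) (x.2.2 ⟨t, le_rfl⟩) j * x.1 j
      have hF : Measurable F := by
        refine Finset.measurable_sum _ fun j _ => Measurable.mul ?_ (by fun_prop)
        refine Fin.addCases (fun i => ?_) (fun i => ?_) j
        · simp only [Fin.append_left]
          fun_prop
        · simp only [Fin.append_right]
          fun_prop
      have hFeq : (fun ω => (R ω *ᵥ B ω) t) = F ∘ fun ω =>
          (B ω, fun u : Fin T => Z u ω, fun u : {u : Fin T // u ≤ t} => X u.1 ω) := by
        ext ω
        simp [F, mulVec, dotProduct, hR]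
      rw [hFeq]
      exact hF.comp (comap_measurable _)
    · filter_upwards [hbd, hBsupp] with ω h1 h2
      exact hC (R ω, B ω) ⟨h1.2.1, h2⟩
  have hexpand : ∀ (lam : ℝ) (mu : ((t : Fin T) × Fin (L t)) → ℝ) (ω : Ω),
      momentFunction lam mu (Y ω) (R ω) (S ω) (B ω)
        = lam * ∑ t, (R ω *ᵥ B ω) t * (Y ω t - R ω t ⬝ᵥ B ω)
          + ∑ pr, mu pr * (St pr.1 ω pr.2 * (Y ω pr.1 - R ω pr.1 ⬝ᵥ B ω)) := by
    intro lam mu ω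
    unfold momentFunction
    rw [dotProduct_mulVec, vecMul_transpose]
    congr 1
    refine Finset.sum_congr rfl fun pr _ => ?_
    simp [mulVec, dotProduct, hSdef]
  have hfitint : ∀ lam : ℝ, Integrable (fun ω =>
      lam * ∑ t, (R ω *ᵥ B ω) t * (Y ω t - R ω t ⬝ᵥ B ω)) μ := fun lam =>
    (integrable_finsetSum _ fun t _ => (hfit t).1).const_mul lam
  have hinstint : ∀ mu : ((t : Fin T) × Fin (L t)) → ℝ, Integrable (fun ω =>
      ∑ pr, mu pr * (St pr.1 ω pr.2 * (Y ω pr.1 - R ω pr.1 ⬝ᵥ B ω))) μ := fun mu =>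
    integrable_finsetSum _ fun pr _ => (hSεint pr.1 pr.2).const_mul _
  have hint : ∀ (lam : ℝ) (mu : ((t : Fin T) × Fin (L t)) → ℝ),
      Integrable (fun ω => momentFunction lam mu (Y ω) (R ω) (S ω) (B ω)) μ := by
    intro lam mu
    simp only [hexpand]
    exact (hfitint lam).add (hinstint mu)
  have hzero : ∀ (lam : ℝ) (mu : ((t : Fin T) × Fin (L t)) → ℝ),
      ∫ ω, momentFunction lam mu (Y ω) (R ω) (S ω) (B ω) ∂μ = 0 := by
    intro lam mu
    simp only [hexpand]
    rw [integral_add (hfitint lam) (hinstint mu), integral_const_mul,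
      integral_finsetSum _ fun t _ => (hfit t).1,
      integral_finsetSum _ fun pr _ => (hSεint pr.1 pr.2).const_mul _]
    simp [(hfit _).2, integral_const_mul, hSε]
  have hs : MeasurableSet {ω | e ⬝ᵥ B ω ≤ cc} := by
    refine measurableSet_le ?_ measurable_const
    unfold dotProduct
    fun_prop
  have hmeas : ∀ (lam : ℝ) (mu : ((t : Fin T) × Fin (L t)) → ℝ) (b : Fin (q + p) → ℝ),
      Measurable fun ω => momentFunction lam mu (Y ω) (R ω) (S ω) b := fun lam mu =>
    measurable_momentFunction lam mu (fun t => (measurable_pi_apply t).comp hY) hRm hSm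
  have hcont : ∀ (lam : ℝ) (mu : ((t : Fin T) × Fin (L t)) → ℝ) (ω : Ω),
      Continuous (momentFunction lam mu (Y ω) (R ω) (S ω)) := fun lam mu ω =>
    (continuous_momentFunction lam mu).comp
      (continuous_const.prodMk (continuous_const.prodMk (continuous_const.prodMk continuous_id)))
  have hbound : ∀ (lam : ℝ) (mu : ((t : Fin T) × Fin (L t)) → ℝ), ∃ C, ∀ᵐ ω ∂μ, ∀ b ∈ Bset,
      |momentFunction lam mu (Y ω) (R ω) (S ω) b| ≤ C := by
    intro lam mu
    obtain ⟨C, hC⟩ := exists_abs_momentFunction_le (m := Fin T) lam mu c hBcomp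
    refine ⟨C, ?_⟩
    filter_upwards [hbd] with ω hω
    exact hC _ _ _ hω.1 hω.2.1 hω.2.2
  simp only [add_assoc]
  constructor
  · refine Real.iSup_le (fun lam => Real.iSup_le (fun mu => ?_) ENNReal.toReal_nonneg)
      ENNReal.toReal_nonneg
    obtain ⟨C, hC⟩ := hbound lam.1 mu
    exact integral_min_iInf_le_measure (φ := fun b => e ⬝ᵥ b) hs (hint lam.1 mu) (hzero lam.1 mu)
      hBsupp (hmeas lam.1 mu) (hcont lam.1 mu) hC hne1 hne2
  · have : Nonempty {x : ℝ // 0 < x} := ⟨⟨1, one_pos⟩⟩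
    refine le_ciInf fun lam => le_ciInf fun mu => ?_
    obtain ⟨C, hC⟩ := hbound lam.1 mu
    exact measure_le_integral_max_iSup (φ := fun b => e ⬝ᵥ b) hs (hint lam.1 mu) (hzero lam.1 mu)
      hBsupp (hmeas lam.1 mu) (hcont lam.1 mu) hC hne1 hne2
end
end
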